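/- Let v₀ ∈ ℝ^n, let (d_k)_{k≥0} be probability vectors in ℝ^n, define the R1-VI iterates v_{k+1} = T(v_k) + α_k 𝟙 with α_k = (γ/(1−γ)) ⟨d_k, T(v_k) − v_k⟩, and let β₀ = 0, β_{k+1} = γβ_k + α_k. Then for every k ≥ 0, α_k = (γ/(1−γ)) ⟨d_k, T^{(k+1)}(v₀) − T^{(k)}(v₀)⟩ − γβ_k, where T^{(k)} denotes the k-fold composition of T (with T^{(0)} the identity). -/

import Mathlib

/-- The Bellman operator maps a constant shift by `r` to a constant shift by `γ * r`. -/
lemma bellman_add_const {S A : Type*} [Fintype S] [Fintype A] [Nonempty A]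
    {P : S → A → S → ℝ} (hP1 : ∀ s a, ∑ s', P s a s' = 1) {c : S → A → ℝ} {γ : ℝ}
    {T : (S → ℝ) → (S → ℝ)}
    (hT : ∀ v s, T v s = ⨅ a, (c s a + γ * ∑ s', P s a s' * v s')) (w : S → ℝ) (r : ℝ) :
    T (fun s => w s + r) = fun s => T w s + γ * r := by
  funext s
  rw [hT, hT, ciInf_add (Set.finite_range _).bddBelow]
  congr 1
  funext a
  simp only [mul_add, Finset.sum_add_distrib, ← Finset.sum_mul, hP1]
  ring

/-- For the R1-VI iterates, the shifts `α k` satisfy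
`α k = (γ/(1-γ)) ⟨d k, T^(k+1)(v 0) - T^(k)(v 0)⟩ - γ β k`. -/
theorem stmt6 {S A : Type*} [Fintype S] [Nonempty S] [Fintype A] [Nonempty A]
    (P : S → A → S → ℝ)
    (hP0 : ∀ s a s', 0 ≤ P s a s')
    (hP1 : ∀ s a, ∑ s', P s a s' = 1)
    (c : S → A → ℝ) (γ : ℝ) (hγ : γ ∈ Set.Ioo (0 : ℝ) 1)
    (T : (S → ℝ) → (S → ℝ))
    (hT : ∀ v s, T v s = ⨅ a, (c s a + γ * ∑ s', P s a s' * v s'))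
    (d : ℕ → S → ℝ) (hd0 : ∀ k s, 0 ≤ d k s) (hd1 : ∀ k, ∑ s, d k s = 1)
    (v : ℕ → S → ℝ) (α β : ℕ → ℝ)
    (hα : ∀ k, α k = γ / (1 - γ) * ∑ s, d k s * (T (v k) s - v k s))
    (hv : ∀ k, v (k + 1) = fun s => T (v k) s + α k)
    (hβ0 : β 0 = 0)
    (hβ : ∀ k, β (k + 1) = γ * β k + α k) :
    ∀ k, α k = γ / (1 - γ) * (∑ s, d k s * (T^[k + 1] (v 0) s - T^[k] (v 0) s)) - γ * β k := by
  have h_iter : ∀ k, v k = fun s => T^[k] (v 0) s + β k := by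
    intro k
    induction k with
    | zero => simp [hβ0]
    | succ k ih =>
      rw [hv, hβ, Function.iterate_succ_apply', ih, bellman_add_const hP1 hT]
      funext s
      ring
  intro k
  have h_shift : ∑ s, d k s * (T (v k) s - v k s) =
      ∑ s, d k s * (T^[k + 1] (v 0) s - T^[k] (v 0) s) - (1 - γ) * β k := by
    calc
      _ = ∑ s, (d k s * (T^[k + 1] (v 0) s - T^[k] (v 0) s) - d k s * ((1 - γ) * β k)) := by
        refine Finset.sum_congr rfl fun s _ => ?_
        rw [h_iter k, bellman_add_const hP1 hT, Function.iterate_succ_apply']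
        ring
      _ = _ := by rw [Finset.sum_sub_distrib, ← Finset.sum_mul, hd1, one_mul]
  have h_ne : 1 - γ ≠ 0 := (sub_pos.2 hγ.2).ne'
  rw [hα, h_shift]
  field_simp
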